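/- Let (α, 𝒜, μ) be a measure space and let p, q : α → ℝ be measurable functions with p(x) > 0 and q(x) > 0 for μ-almost every x. Let F : α → ℝ be measurable with 0 < F(x) < 1 for μ-almost every x, and assume the functions x ↦ p(x)·log F(x) + q(x)·log(1−F(x)) and x ↦ p(x)·log(p(x)/(p(x)+q(x))) + q(x)·log(q(x)/(p(x)+q(x))) are μ-integrable. Then ∫ (p·log F + q·log(1−F)) dμ ≤ ∫ (p·log(p/(p+q)) + q·log(q/(p+q))) dμ. -/

import Mathlib

open MeasureTheory

/-- The tangent-line bound for `t ↦ a * log t` at the point `t = a / s`. -/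
theorem mul_log_le_mul_log_div_add {a s t : ℝ} (ha : 0 < a) (hs : 0 < s) (ht : 0 < t) :
    a * Real.log t ≤ a * Real.log (a / s) + (t * s - a) := by
  have hlog : Real.log (t / (a / s)) = Real.log t - Real.log (a / s) :=
    Real.log_div ht.ne' (div_pos ha hs).ne'
  have hle := mul_le_mul_of_nonneg_left
    (Real.log_le_sub_one_of_pos (div_pos ht (div_pos ha hs))) ha.le
  have heq : a * (t / (a / s) - 1) = t * s - a := by
    field_simp
  rw [hlog, heq] at hle
  linarith

/-- For positive weights `a` and `b`, the function `t ↦ a * log t + b * log (1 - t)` on `(0, 1)`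
is at most its value at `t = a / (a + b)`. -/
theorem mul_log_add_mul_log_one_sub_le {a b t : ℝ} (ha : 0 < a) (hb : 0 < b)
    (ht0 : 0 < t) (ht1 : t < 1) :
    a * Real.log t + b * Real.log (1 - t) ≤
      a * Real.log (a / (a + b)) + b * Real.log (b / (a + b)) := by
  have h1 := mul_log_le_mul_log_div_add ha (add_pos ha hb) ht0
  have h2 := mul_log_le_mul_log_div_add hb (add_pos ha hb) (sub_pos.mpr ht1)
  linarith

/-- Integrated optimal-discriminator step: for a.e.-positive densities `p`, `q` and any
measurable detector `F` with values a.e. in `(0,1)`, provided both integrands are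
integrable, the detector objective `∫ p·log F + q·log(1-F)` is at most its value at the
pointwise optimum `F* = p/(p+q)`. -/
theorem integral_detector_objective_le {α : Type*} [MeasurableSpace α] (μ : Measure α)
    (p q F : α → ℝ) (hp : Measurable p) (hq : Measurable q) (hF : Measurable F)
    (hp0 : ∀ᵐ x ∂μ, 0 < p x) (hq0 : ∀ᵐ x ∂μ, 0 < q x)
    (hF01 : ∀ᵐ x ∂μ, 0 < F x ∧ F x < 1)
    (hint1 : Integrable (fun x => p x * Real.log (F x) + q x * Real.log (1 - F x)) μ)
    (hint2 : Integrable (fun x => p x * Real.log (p x / (p x + q x)) +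
      q x * Real.log (q x / (p x + q x))) μ) :
    ∫ x, (p x * Real.log (F x) + q x * Real.log (1 - F x)) ∂μ ≤
      ∫ x, (p x * Real.log (p x / (p x + q x)) +
        q x * Real.log (q x / (p x + q x))) ∂μ := by
  refine integral_mono_ae hint1 hint2 ?_
  filter_upwards [hp0, hq0, hF01] with x hpx hqx hFx
  exact mul_log_add_mul_log_one_sub_le hpx hqx hFx.1 hFx.2
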